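/- arXiv:2402.07043 — 2 statements merged into one kernel-verified Lean document; each statement's English description precedes it below -/
import Mathlib

section
/- Let β > 1, c := 1 − 1/β, and let p be the Zipf distribution with exponent β, p_i = i^{-β}/ζ(β). Fix π ∈ (0,1) and for integers T, k define the mixture test error E(π,T,k) := Σ_{i=1}^{k} p_i (1 − p_i)^T + Σ_{i ≥ k+1} p_i (1 − π p_i)^T (the test error of a Hutter model trained on a size-T sample of which a proportion π is clean data from p and the rest is AI data with tail chopped at rank k). Then (early-stage dynamics) there exist δ > 0 and constants C₁, C₂ > 0, depending only on β and π, such that for all sufficiently large T and k with T ≤ δ·k^β/π: C₁·(T^{-c} + k^{-(β-1)}) ≤ E(π,T,k) ≤ C₂·(T^{-c} + k^{-(β-1)}). Thus during this stage the clean data is not amortized: the scaling is as if all data were AI-generated. -/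
/-- The Zipf distribution with exponent `β` on the positive integers:
`p i = i^(-β) / ζ(β)`, with `ζ(β) = ∑_{j ≥ 1} j^(-β)`.  (`zipf β 0 = 0`.) -/
noncomputable def zipf (β : ℝ) (i : ℕ) : ℝ :=
  (i : ℝ) ^ (-β) / ∑' j : ℕ, ((j : ℝ) + 1) ^ (-β)

/-- Test error of the Hutter model trained on a size-`T` sample of which a proportion
`π` is clean data from the Zipf distribution `p` and the rest is AI data with tail
chopped at rank `k`:
`E(π,T,k) = ∑_{i=1}^k p_i (1-p_i)^T + ∑_{i ≥ k+1} p_i (1-π p_i)^T`. -/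
noncomputable def EtestMix (β πc : ℝ) (T k : ℕ) : ℝ :=
  (∑ i ∈ Finset.Icc 1 k, zipf β i * (1 - zipf β i) ^ T) +
    ∑' i : ℕ, if k + 1 ≤ i then zipf β i * (1 - πc * zipf β i) ^ T else 0

lemma aux_summable (β : ℝ) (hβ : 1 < β) : Summable (fun j : ℕ => (j : ℝ) ^ (-β)) :=
  Real.summable_nat_rpow.2 (by linarith)

lemma aux_Z (β : ℝ) (hβ : 1 < β) : 1 ≤ ∑' j : ℕ, ((j : ℝ) + 1) ^ (-β) := by
  have h : Summable (fun j : ℕ => ((j : ℝ) + 1) ^ (-β)) := by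
    have := (summable_nat_add_iff 1).2 (aux_summable β hβ)
    simpa using this
  have := h.le_tsum 0 (fun j _ => by positivity)
  simpa using this

lemma aux_zipf_nonneg (β : ℝ) (hβ : 1 < β) (i : ℕ) : 0 ≤ zipf β i := by
  have := aux_Z β hβ
  unfold zipf
  positivity

lemma aux_zipf_le (β : ℝ) (hβ : 1 < β) (i : ℕ) : zipf β i ≤ (i : ℝ) ^ (-β) := by
  have := aux_Z β hβ
  unfold zipf
  exact div_le_self (by positivity) this

lemma aux_zipf_zero (β : ℝ) (hβ : 1 < β) : zipf β 0 = 0 := by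
  unfold zipf
  rw [Nat.cast_zero, Real.zero_rpow (by linarith), zero_div]

lemma aux_zipf_le_one (β : ℝ) (hβ : 1 < β) (i : ℕ) : zipf β i ≤ 1 := by
  rcases Nat.eq_zero_or_pos i with rfl | hi
  · rw [aux_zipf_zero β hβ]; norm_num
  · refine (aux_zipf_le β hβ i).trans ?_
    exact Real.rpow_le_one_of_one_le_of_nonpos (by exact_mod_cast hi) (by linarith)

lemma aux_zipf_summable (β : ℝ) (hβ : 1 < β) : Summable (zipf β) := by
  unfold zipf
  exact (aux_summable β hβ).div_const _

/-- The effective sampling rate at rank `i`. -/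
noncomputable def qq (β πc : ℝ) (k i : ℕ) : ℝ := if i ≤ k then zipf β i else πc * zipf β i

/-- The summand of the mixture error. -/
noncomputable def ff (β πc : ℝ) (T k i : ℕ) : ℝ := zipf β i * (1 - qq β πc k i) ^ T

lemma aux_qq (β πc : ℝ) (hβ : 1 < β) (hπ : πc ∈ Set.Ioo (0 : ℝ) 1) (k i : ℕ) :
    0 ≤ qq β πc k i ∧ qq β πc k i ≤ zipf β i := by
  have h := aux_zipf_nonneg β hβ i
  obtain ⟨h0, h1⟩ := hπ
  unfold qq
  split_ifs
  · exact ⟨h, le_rfl⟩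
  · exact ⟨by positivity, by nlinarith⟩

lemma aux_ff (β πc : ℝ) (hβ : 1 < β) (hπ : πc ∈ Set.Ioo (0 : ℝ) 1) (T k i : ℕ) :
    0 ≤ ff β πc T k i ∧ ff β πc T k i ≤ zipf β i := by
  have h := aux_zipf_nonneg β hβ i
  have h1 := aux_zipf_le_one β hβ i
  obtain ⟨h2, h3⟩ := aux_qq β πc hβ hπ k i
  have h4 : 0 ≤ 1 - qq β πc k i := by linarith
  unfold ff
  refine ⟨by positivity, mul_le_of_le_one_right h (pow_le_one₀ h4 (by linarith))⟩

lemma aux_ff_summable (β πc : ℝ) (hβ : 1 < β) (hπ : πc ∈ Set.Ioo (0 : ℝ) 1) (T k : ℕ) :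
    Summable (ff β πc T k) :=
  Summable.of_nonneg_of_le (fun i => (aux_ff β πc hβ hπ T k i).1)
    (fun i => (aux_ff β πc hβ hπ T k i).2) (aux_zipf_summable β hβ)

lemma aux_E (β πc : ℝ) (hβ : 1 < β) (hπ : πc ∈ Set.Ioo (0 : ℝ) 1) (T k : ℕ) :
    EtestMix β πc T k = ∑' i, ff β πc T k i := by
  have hs := aux_ff_summable β πc hβ hπ T k
  rw [← hs.sum_add_tsum_compl (s := Finset.Icc 1 k)]
  unfold EtestMix
  congr 1
  · refine Finset.sum_congr rfl fun i hi => ?_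
    simp only [ff, qq, if_pos (Finset.mem_Icc.1 hi).2]
  · rw [tsum_subtype ((↑(Finset.Icc 1 k) : Set ℕ)ᶜ) (ff β πc T k)]
    refine tsum_congr fun i => ?_
    rcases Nat.eq_zero_or_pos i with rfl | hi
    · simp [Set.indicator, ff, aux_zipf_zero β hβ]
    · by_cases hk : k + 1 ≤ i
      · have h1 : ¬ i ≤ k := by omega
        simp [Set.indicator, ff, qq, hk, h1]
      · have h1 : i ≤ k := by omega
        have h2 : 1 ≤ i := hi
        simp [Set.indicator, hk, h1, h2]

lemma aux_head (p : ℝ) (T : ℕ) (hT : 1 ≤ T) (h0 : 0 ≤ p) (h1 : p ≤ 1) :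
    p * (1 - p) ^ T ≤ 1 / T := by
  have hT' : (0 : ℝ) < T := by exact_mod_cast hT
  have h2 : (1 - p) ^ T * (1 + T * p) ≤ 1 := by
    calc (1 - p) ^ T * (1 + T * p) ≤ (1 - p) ^ T * (1 + p) ^ T := by
          refine mul_le_mul_of_nonneg_left (one_add_mul_le_pow (by linarith) T) ?_
          exact pow_nonneg (by linarith) T
      _ = (1 - p ^ 2) ^ T := by rw [← mul_pow]; ring
      _ ≤ 1 := pow_le_one₀ (by nlinarith) (by nlinarith)
  have h3 : 0 ≤ (1 - p) ^ T := pow_nonneg (by linarith) T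
  rw [le_div_iff₀ hT']
  nlinarith

lemma aux_tele (β : ℝ) (hβ : 1 < β) (m : ℕ) (hm : 1 ≤ m) :
    ((m + 1 : ℕ) : ℝ) ^ (-β) ≤ ((m : ℝ) ^ (1 - β) - ((m + 1 : ℕ) : ℝ) ^ (1 - β)) / (β - 1) := by
  have hm' : (0 : ℝ) < m := by exact_mod_cast hm
  have hx : (0 : ℝ) < ((m + 1 : ℕ) : ℝ) := by positivity
  rw [le_div_iff₀ (by linarith)]
  obtain ⟨x, hxx⟩ : ∃ x : ℝ, x = ((m + 1 : ℕ) : ℝ) := ⟨_, rfl⟩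
  have hmx : (m : ℝ) = x * (1 + -x⁻¹) := by
    rw [hxx]; field_simp; push_cast; ring
  rw [← hxx] at hx ⊢
  have hpos : 0 < 1 + -x⁻¹ := by
    by_contra h
    nlinarith
  have hb : 1 + (1 - β) * (-x⁻¹) ≤ (1 + -x⁻¹) ^ (1 - β) := by
    rw [Real.rpow_def_of_pos hpos]
    have a1 := Real.add_one_le_exp (Real.log (1 + -x⁻¹) * (1 - β))
    have a2 := Real.log_le_sub_one_of_pos hpos
    nlinarith
  rw [hmx, Real.mul_rpow hx.le hpos.le]
  have h1 : x ^ (-β) = x ^ (1 - β) * x⁻¹ := by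
    rw [← Real.rpow_neg_one x, ← Real.rpow_add hx]; ring_nf
  have h2 : 0 ≤ x ^ (1 - β) := by positivity
  rw [h1]
  nlinarith [mul_le_mul_of_nonneg_left hb h2]

lemma aux_upper (β πc : ℝ) (hβ : 1 < β) (hπ : πc ∈ Set.Ioo (0 : ℝ) 1) (T k N : ℕ)
    (hT : 1 ≤ T) (hN : 1 ≤ N) (hNk : N ≤ k) :
    ∑' i, ff β πc T k i ≤ (N + 1) / T + (N : ℝ) ^ (1 - β) / (β - 1) := by
  have hβ' : 0 < β - 1 := by linarith
  have key : ∀ n : ℕ, ∑ i ∈ Finset.range (N + 1 + n), ff β πc T k i ≤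
      (N + 1) / T + ((N : ℝ) ^ (1 - β) - ((N + n : ℕ) : ℝ) ^ (1 - β)) / (β - 1) := by
    intro n
    induction n with
    | zero =>
      have : ∑ i ∈ Finset.range (N + 1), ff β πc T k i ≤
          ∑ i ∈ Finset.range (N + 1), (1 / T : ℝ) := by
        refine Finset.sum_le_sum fun i hi => ?_
        have hi' : i ≤ k := by have := Finset.mem_range.1 hi; omega
        simp only [ff, qq, if_pos hi']
        exact aux_head _ T hT (aux_zipf_nonneg β hβ i) (aux_zipf_le_one β hβ i)
      simp only [Finset.sum_const, Finset.card_range, nsmul_eq_mul] at this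
      simp only [add_zero, sub_self, zero_div]
      refine this.trans (le_of_eq ?_)
      push_cast; ring
    | succ n ih =>
      rw [← add_assoc, Finset.sum_range_succ]
      have h1 := ((aux_ff β πc hβ hπ T k (N + n + 1)).2.trans
        (aux_zipf_le β hβ _)).trans (aux_tele β hβ (N + n) (by omega))
      have e : N + 1 + n = N + n + 1 := by ring
      rw [e] at ih ⊢
      rw [← add_assoc N n 1]
      rw [sub_div] at *
      linarith
  refine Real.tsum_le_of_sum_range_le (fun i => (aux_ff β πc hβ hπ T k i).1) fun n => ?_
  calc ∑ i ∈ Finset.range n, ff β πc T k i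
      ≤ ∑ i ∈ Finset.range (N + 1 + n), ff β πc T k i :=
        Finset.sum_le_sum_of_subset_of_nonneg (Finset.range_mono (by omega))
          (fun i _ _ => (aux_ff β πc hβ hπ T k i).1)
    _ ≤ _ := key n
    _ ≤ _ := by
      gcongr
      have : 0 ≤ ((N + n : ℕ) : ℝ) ^ (1 - β) := by positivity
      linarith

lemma aux_lower (β πc : ℝ) (hβ : 1 < β) (hπ : πc ∈ Set.Ioo (0 : ℝ) 1) (T k N : ℕ)
    (hN : 1 ≤ N) (hTN : (T : ℝ) ≤ (N : ℝ) ^ β) :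
    (N : ℝ) * ((4 * N : ℝ) ^ (-β) / ∑' j : ℕ, ((j : ℝ) + 1) ^ (-β)) ≤
      ∑' i, ff β πc T k i := by
  have hZ := aux_Z β hβ
  have hN' : (0 : ℝ) < N := by exact_mod_cast hN
  have hs := aux_ff_summable β πc hβ hπ T k
  refine le_trans ?_ (hs.sum_le_tsum (Finset.Ioc (2 * N) (4 * N))
    (fun i _ => (aux_ff β πc hβ hπ T k i).1))
  have hcard := Finset.card_nsmul_le_sum (Finset.Ioc (2 * N) (4 * N)) (ff β πc T k)
    (((4 * N : ℝ) ^ (-β) / ∑' j : ℕ, ((j : ℝ) + 1) ^ (-β)) * (1 / 2)) ?_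
  · refine le_trans (le_of_eq ?_) hcard
    rw [Nat.card_Ioc, nsmul_eq_mul, show 4 * N - 2 * N = 2 * N by omega]
    push_cast
    ring
  intro i hi
  obtain ⟨h1, h2⟩ := Finset.mem_Ioc.1 hi
  have h1' : (2 * N : ℝ) ≤ i := by exact_mod_cast h1.le
  have h2' : (i : ℝ) ≤ 4 * N := by exact_mod_cast h2
  have hi0 : (0 : ℝ) < i := by linarith
  obtain ⟨hq0, hq1⟩ := aux_qq β πc hβ hπ k i
  have hz := aux_zipf_le_one β hβ i
  have hq : qq β πc k i * T ≤ 1 / 2 := by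
    have a1 : qq β πc k i ≤ (2 * N : ℝ) ^ (-β) :=
      (hq1.trans (aux_zipf_le β hβ i)).trans
        (Real.rpow_le_rpow_of_nonpos (by positivity) h1' (by linarith))
    calc qq β πc k i * T ≤ (2 * N : ℝ) ^ (-β) * (N : ℝ) ^ β := by gcongr
      _ = (2 : ℝ) ^ (-β) := by
        rw [Real.mul_rpow (by norm_num) hN'.le, mul_assoc, ← Real.rpow_add hN']
        simp
      _ ≤ (2 : ℝ) ^ (-1 : ℝ) :=
        Real.rpow_le_rpow_of_exponent_le (by norm_num) (by linarith)
      _ = 1 / 2 := by rw [Real.rpow_neg_one]; norm_num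
  have hb : 1 / 2 ≤ (1 - qq β πc k i) ^ T := by
    have := one_add_mul_le_pow (a := -qq β πc k i) (by linarith) T
    rw [← sub_eq_add_neg] at this
    linarith
  have hp : (4 * N : ℝ) ^ (-β) / ∑' j : ℕ, ((j : ℝ) + 1) ^ (-β) ≤ zipf β i := by
    unfold zipf
    gcongr ?_ / _
    exact Real.rpow_le_rpow_of_nonpos hi0 h2' (by linarith)
  unfold ff
  have := aux_zipf_nonneg β hβ i
  gcongr

/-- Early-stage dynamics of mixing clean and AI data: for `β > 1`,
`c = 1 - 1/β`, and a fixed clean proportion `π ∈ (0,1)`, there is `δ > 0` such that for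
all sufficiently large `T, k` with `T ≤ δ k^β / π` the test error is of order
`T^(-c) + k^(-(β-1))`: the clean data is not amortized. -/
theorem grokking_early_stage (β : ℝ) (hβ : 1 < β) (c : ℝ) (hc : c = 1 - 1 / β)
    (πc : ℝ) (hπ : πc ∈ Set.Ioo (0 : ℝ) 1) :
    ∃ δ : ℝ, 0 < δ ∧ ∃ C₁ C₂ : ℝ, 0 < C₁ ∧ 0 < C₂ ∧ ∃ T₀ k₀ : ℕ,
      ∀ T k : ℕ, T₀ ≤ T → k₀ ≤ k → (T : ℝ) ≤ δ * (k : ℝ) ^ β / πc →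
        C₁ * ((T : ℝ) ^ (-c) + (k : ℝ) ^ (-(β - 1))) ≤ EtestMix β πc T k ∧
        EtestMix β πc T k ≤ C₂ * ((T : ℝ) ^ (-c) + (k : ℝ) ^ (-(β - 1))) := by
  have hZ := aux_Z β hβ
  have hβ' : 0 < β - 1 := by linarith
  have hβ0 : 0 < β := by linarith
  obtain ⟨Z, hZe⟩ : ∃ Z : ℝ, Z = ∑' j : ℕ, ((j : ℝ) + 1) ^ (-β) := ⟨_, rfl⟩
  rw [← hZe] at hZ
  have hZ0 : 0 < Z := by linarith
  refine ⟨πc, hπ.1, (4 : ℝ) ^ (-β) * (2 : ℝ) ^ (1 - β) / Z / 2, 3 + 1 / (β - 1),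
    by positivity, by positivity, 1, 1, ?_⟩
  intro T k hT hk hTk
  rw [mul_div_assoc, mul_div_cancel₀ _ hπ.1.ne'] at hTk
  have hT1 : (1 : ℝ) ≤ T := by exact_mod_cast hT
  have hk1 : (1 : ℝ) ≤ k := by exact_mod_cast hk
  obtain ⟨u, hu⟩ : ∃ u : ℝ, u = (T : ℝ) ^ (1 / β) := ⟨_, rfl⟩
  have hu1 : 1 ≤ u := by rw [hu]; exact Real.one_le_rpow hT1 (by positivity)
  have hu0 : 0 < u := by linarith
  have huT : u ^ β = T := by
    rw [hu, ← Real.rpow_mul (by positivity), one_div_mul_cancel hβ0.ne', Real.rpow_one]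
  have huc : (T : ℝ) ^ (-c) = u ^ (1 - β) := by
    rw [hu, ← Real.rpow_mul (by positivity), hc]
    congr 1
    field_simp
    ring
  have huk : u ≤ k := by
    rw [← huT] at hTk
    exact (Real.rpow_le_rpow_iff hu0.le (by positivity) hβ0).1 hTk
  have hk2 : (k : ℝ) ^ (-(β - 1)) ≤ u ^ (1 - β) := by
    rw [neg_sub]
    exact Real.rpow_le_rpow_of_nonpos hu0 huk (by linarith)
  have hk3 : 0 ≤ (k : ℝ) ^ (-(β - 1)) := by positivity
  obtain ⟨N, hN⟩ : ∃ N : ℕ, N = ⌈u⌉₊ := ⟨_, rfl⟩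
  have hN1 : u ≤ N := by rw [hN]; exact Nat.le_ceil u
  have hN2 : (N : ℝ) ≤ 2 * u := by
    have := Nat.ceil_lt_add_one hu0.le
    rw [← hN] at this
    linarith
  have hN3 : 1 ≤ N := by
    have : (1 : ℝ) ≤ N := by linarith
    exact_mod_cast this
  have hN0 : (0 : ℝ) < N := by linarith
  have hNk : N ≤ k := by rw [hN]; exact Nat.ceil_le.2 huk
  have hup := aux_upper β πc hβ hπ T k N hT hN3 hNk
  have hlo := aux_lower β πc hβ hπ T k N hN3
    (by rw [← huT]; exact Real.rpow_le_rpow hu0.le hN1 hβ0.le)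
  rw [aux_E β πc hβ hπ, huc]
  have hU : 0 < u ^ (1 - β) := by positivity
  constructor
  · refine le_trans ?_ hlo
    rw [← hZe]
    have e1 : (N : ℝ) * ((4 * N : ℝ) ^ (-β) / Z) = (4 : ℝ) ^ (-β) * (N : ℝ) ^ (1 - β) / Z := by
      rw [Real.mul_rpow (by norm_num) hN0.le, sub_eq_add_neg, Real.rpow_add hN0, Real.rpow_one]
      ring
    have e2 : (2 : ℝ) ^ (1 - β) * u ^ (1 - β) ≤ (N : ℝ) ^ (1 - β) := by
      rw [← Real.mul_rpow (by norm_num) hu0.le]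
      exact Real.rpow_le_rpow_of_nonpos hN0 hN2 (by linarith)
    rw [e1]
    calc (4 : ℝ) ^ (-β) * (2 : ℝ) ^ (1 - β) / Z / 2 * (u ^ (1 - β) + (k : ℝ) ^ (-(β - 1)))
        ≤ (4 : ℝ) ^ (-β) * (2 : ℝ) ^ (1 - β) / Z / 2 * (u ^ (1 - β) + u ^ (1 - β)) := by gcongr
      _ = (4 : ℝ) ^ (-β) * ((2 : ℝ) ^ (1 - β) * u ^ (1 - β)) / Z := by ring
      _ ≤ _ := by gcongr
  · refine hup.trans ?_
    have e1 : ((N : ℝ) + 1) / T ≤ 3 * u ^ (1 - β) := by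
      rw [← huT, sub_eq_add_neg, Real.rpow_add hu0, Real.rpow_one, Real.rpow_neg hu0.le,
        ← mul_assoc, ← div_eq_mul_inv]
      gcongr
      linarith
    have e2 : (N : ℝ) ^ (1 - β) / (β - 1) ≤ 1 / (β - 1) * u ^ (1 - β) := by
      rw [one_div_mul_eq_div]
      gcongr ?_ / _
      exact Real.rpow_le_rpow_of_nonpos hu0 hN1 (by linarith)
    have e3 : 0 ≤ (3 + 1 / (β - 1)) * (k : ℝ) ^ (-(β - 1)) := by positivity
    linarith
end

section
/- Let β > 1, c := 1 − 1/β, and let p be the Zipf distribution with exponent β, p_i = i^{-β}/ζ(β). Let T_AI ≥ 0 be a fixed AI-dataset size and T_real ≥ 1 a clean-dataset size; set T := T_real + T_AI and π := T_real/T, and define E := Σ_{i=1}^{k} p_i (1 − p_i)^T + Σ_{i ≥ k+1} p_i (1 − π p_i)^T. Then: (A) there exist δ > 0 and constants C₁, C₂ > 0, depending only on β, such that for all sufficiently large k, T with T_real ≤ δ·k^β: C₁·((T_real + T_AI)^{-c} + k^{-(β-1)}) ≤ E ≤ C₂·((T_real + T_AI)^{-c} + k^{-(β-1)}); (B) there exist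 an absolute constant C and constants C₁', C₂' > 0, depending only on β, such that whenever T_real ≥ C·k^β: C₁'·T_real^{-c} ≤ E ≤ C₂'·T_real^{-c}. Thus AI data helps when real data is scarce, and after a grokking plateau the model recovers the clean scaling law in T_real alone. -/
namespace Grok

noncomputable def Z (β : ℝ) : ℝ := ∑' j : ℕ, ((j : ℝ) + 1) ^ (-β)

lemma zipf_eq (β : ℝ) (i : ℕ) : zipf β i = (i : ℝ) ^ (-β) / Z β := rfl

lemma summ0 {β : ℝ} (hβ : 1 < β) : Summable (fun j : ℕ => (j : ℝ) ^ (-β)) :=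
  Real.summable_nat_rpow.2 (by linarith)

lemma summ1 {β : ℝ} (hβ : 1 < β) : Summable (fun j : ℕ => ((j : ℝ) + 1) ^ (-β)) := by
  have := (summable_nat_add_iff 1).2 (summ0 hβ)
  simpa using this

lemma Z_ge {β : ℝ} (hβ : 1 < β) : 1 ≤ Z β := by
  have := (summ1 hβ).le_tsum 0 (fun j _ => by positivity)
  simpa [Z] using this

lemma Z_pos {β : ℝ} (hβ : 1 < β) : 0 < Z β := lt_of_lt_of_le one_pos (Z_ge hβ)

lemma zipf_zero {β : ℝ} (hβ : 1 < β) : zipf β 0 = 0 := by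
  rw [zipf_eq]
  simp [Real.zero_rpow (show (-β) ≠ 0 by linarith)]

lemma zipf_nonneg {β : ℝ} (hβ : 1 < β) (i : ℕ) : 0 ≤ zipf β i := by
  rw [zipf_eq]
  have := Z_pos hβ
  positivity

lemma zipf_le_one {β : ℝ} (hβ : 1 < β) (i : ℕ) : zipf β i ≤ 1 := by
  rcases Nat.eq_zero_or_pos i with h | h
  · subst h; rw [zipf_zero hβ]; exact zero_le_one
  · rw [zipf_eq, div_le_one (Z_pos hβ)]
    refine le_trans ?_ (Z_ge hβ)
    exact Real.rpow_le_one_of_one_le_of_nonpos (by exact_mod_cast h) (by linarith)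

lemma zipf_summable {β : ℝ} (hβ : 1 < β) : Summable (zipf β) :=
  (summ0 hβ).div_const _

/-- telescoping step -/
lemma step {s : ℝ} (hs : 0 < s) (i : ℕ) (hi : 1 ≤ i) :
    s * ((i : ℝ) + 1) ^ (-(s + 1)) ≤ (i : ℝ) ^ (-s) - ((i : ℝ) + 1) ^ (-s) := by
  have hi' : (0 : ℝ) < i := by exact_mod_cast hi
  have h1 : (0 : ℝ) < (i : ℝ) + 1 := by linarith
  have e1 : ((i : ℝ) + 1) ^ (-(s + 1)) = ((i : ℝ) + 1) ^ (-s) / ((i : ℝ) + 1) := by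
    rw [show -(s + 1) = -s - 1 by ring, Real.rpow_sub_one h1.ne']
  have e2 : (i : ℝ) ^ (-s) = ((i : ℝ) + 1) ^ (-s) * ((i : ℝ) / (i + 1)) ^ (-s) := by
    rw [← Real.mul_rpow h1.le (by positivity)]
    congr 1
    field_simp
  have hy : (0 : ℝ) < (i : ℝ) / (i + 1) := by positivity
  have e3 : 1 + s / ((i : ℝ) + 1) ≤ ((i : ℝ) / (i + 1)) ^ (-s) := by
    rw [Real.rpow_def_of_pos hy]
    have a := Real.add_one_le_exp (Real.log ((i : ℝ) / (i + 1)) * -s)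
    have b := Real.log_le_sub_one_of_pos hy
    have e : (i : ℝ) / (i + 1) - 1 = - (1 / ((i : ℝ) + 1)) := by field_simp; ring
    rw [e] at b
    have := mul_le_mul_of_nonneg_left b hs.le
    have e' : s / ((i : ℝ) + 1) = s * (1 / ((i : ℝ) + 1)) := by ring
    rw [e']
    linarith
  have hp : (0 : ℝ) < ((i : ℝ) + 1) ^ (-s) := Real.rpow_pos_of_pos h1 _
  rw [e1, e2]
  have := mul_le_mul_of_nonneg_left e3 hp.le
  have e4 : s * (((i : ℝ) + 1) ^ (-s) / ((i : ℝ) + 1))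
    = ((i : ℝ) + 1) ^ (-s) * (1 + s / ((i : ℝ) + 1)) - ((i : ℝ) + 1) ^ (-s) := by ring
  linarith

lemma tail_le {β : ℝ} (hβ : 1 < β) (N : ℕ) (hN : 1 ≤ N) :
    ∑' i : ℕ, (if N + 1 ≤ i then zipf β i else 0) ≤ 1 / (β - 1) * (N : ℝ) ^ (-(β - 1)) := by
  have hs : 0 < β - 1 := by linarith
  have hsum : Summable (fun i : ℕ => if N + 1 ≤ i then zipf β i else 0) := by
    refine Summable.of_nonneg_of_le (fun i => ?_) (fun i => ?_) (zipf_summable hβ)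
    · split_ifs <;> simp [zipf_nonneg hβ]
    · split_ifs <;> simp [zipf_nonneg hβ]
  rw [← hsum.sum_add_tsum_nat_add (N + 1)]
  rw [Finset.sum_eq_zero (fun i hi => if_neg (by simp at hi; omega)), zero_add]
  refine Real.tsum_le_of_sum_range_le (fun i => ?_) (fun n => ?_)
  · split_ifs <;> simp [zipf_nonneg hβ]
  · have key : ∀ n : ℕ, ∑ i ∈ Finset.range n, (if N + 1 ≤ i + (N + 1) then zipf β (i + (N + 1)) else 0)
      ≤ 1 / (β - 1) * ((N : ℝ) ^ (-(β - 1)) - ((N + n : ℕ) : ℝ) ^ (-(β - 1))) := by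
      intro n
      induction n with
      | zero => simp
      | succ n ih =>
        rw [Finset.sum_range_succ, if_pos (by omega)]
        have h := step hs (N + n) (by omega)
        have h2 : zipf β (n + (N + 1)) ≤ (((N + n : ℕ) : ℝ) + 1) ^ (-(β - 1 + 1)) := by
          rw [zipf_eq, div_le_iff₀ (Z_pos hβ)]
          have : ((n + (N + 1) : ℕ) : ℝ) = ((N + n : ℕ) : ℝ) + 1 := by push_cast; ring
          rw [this, show -(β - 1 + 1) = -β by ring]
          exact le_mul_of_one_le_right (by positivity) (Z_ge hβ)
        have h3 : zipf β (n + (N + 1)) ≤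
          1 / (β - 1) * (((N + n : ℕ) : ℝ) ^ (-(β - 1)) - (((N + n : ℕ) : ℝ) + 1) ^ (-(β - 1))) := by
          rw [one_div, ← div_eq_inv_mul, le_div_iff₀ hs]
          nlinarith
        have : ((N + (n + 1) : ℕ) : ℝ) = ((N + n : ℕ) : ℝ) + 1 := by push_cast; ring
        rw [this]
        linarith
    refine (key n).trans ?_
    have : (0 : ℝ) ≤ ((N + n : ℕ) : ℝ) ^ (-(β - 1)) := by positivity
    have h4 : 0 ≤ 1 / (β - 1) := by positivity
    exact mul_le_mul_of_nonneg_left (by linarith) h4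

lemma exp_bd {x : ℝ} (hx : 0 < x) : Real.exp (-x) ≤ 2 / x ^ 2 := by
  have := Real.quadratic_le_exp_of_nonneg hx.le
  rw [Real.exp_neg, inv_eq_one_div, div_le_div_iff₀ (Real.exp_pos _) (by positivity)]
  nlinarith

lemma g_summable {β : ℝ} (hβ : 1 < β) (τ : ℝ) (hτ : 0 ≤ τ) :
    Summable (fun i : ℕ => zipf β i * Real.exp (-(τ * zipf β i))) := by
  refine Summable.of_nonneg_of_le (fun i => ?_) (fun i => ?_) (zipf_summable hβ)
  · have := zipf_nonneg hβ i; positivity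
  · refine mul_le_of_le_one_right (zipf_nonneg hβ i) ?_
    rw [Real.exp_le_one_iff]
    have := mul_nonneg hτ (zipf_nonneg hβ i); linarith

noncomputable def B (β : ℝ) : ℝ := 4 * Z β + 1 / (β - 1) * (2 : ℝ) ^ (β - 1)

lemma B_pos {β : ℝ} (hβ : 1 < β) : 0 < B β := by
  have := Z_pos hβ
  have hs : 0 < β - 1 := by linarith
  unfold B; positivity

lemma g_le {β : ℝ} (hβ : 1 < β) {c : ℝ} (hc : c = 1 - 1 / β) (τ : ℝ) (hτ : 1 ≤ τ) :
    ∑' i : ℕ, zipf β i * Real.exp (-(τ * zipf β i)) ≤ B β * τ ^ (-c) := by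
  have hτ0 : 0 < τ := by linarith
  have hs : 0 < β - 1 := by linarith
  have hβ0 : 0 < β := by linarith
  have hZ := Z_pos hβ
  set R : ℝ := τ ^ (1 / β) with hR
  have hR1 : 1 ≤ R := Real.one_le_rpow hτ (by positivity)
  have hRβ : R ^ β = τ := by
    rw [hR, ← Real.rpow_mul hτ0.le, one_div_mul_cancel hβ0.ne', Real.rpow_one]
  set N : ℕ := ⌊R⌋₊ with hN
  have hN1 : 1 ≤ N := Nat.one_le_floor_iff _ |>.2 hR1
  have hN1' : (1 : ℝ) ≤ N := by exact_mod_cast hN1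
  have hNR : (N : ℝ) ≤ R := Nat.floor_le (by linarith)
  have hRN : R / 2 ≤ N := by
    have := Nat.lt_floor_add_one R
    rw [← hN] at this
    linarith
  have hτc : τ ^ (-c) = R / τ := by
    rw [hc, hR, show -(1 - 1 / β) = 1 / β - 1 by ring, Real.rpow_sub_one hτ0.ne']
  have hτc2 : τ ^ (-c) = R ^ (-(β - 1)) := by
    rw [hR, ← Real.rpow_mul hτ0.le, hc]; congr 1; field_simp
  have hsum1 : Summable (fun i : ℕ => if i ∈ Finset.range (N + 1) then 2 * Z β / τ else 0) :=
    summable_of_ne_finset_zero (s := Finset.range (N + 1)) (fun i hi => if_neg hi)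
  have hsum2 : Summable (fun i : ℕ => if N + 1 ≤ i then zipf β i else 0) := by
    refine Summable.of_nonneg_of_le (fun i => ?_) (fun i => ?_) (zipf_summable hβ)
    · split_ifs <;> simp [zipf_nonneg hβ]
    · split_ifs <;> simp [zipf_nonneg hβ]
  have hle : ∀ i : ℕ, zipf β i * Real.exp (-(τ * zipf β i)) ≤
      (if i ∈ Finset.range (N + 1) then 2 * Z β / τ else 0) + (if N + 1 ≤ i then zipf β i else 0) := by
    intro i
    by_cases h : N + 1 ≤ i
    · rw [if_neg (by simp; omega), if_pos h, zero_add]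
      refine mul_le_of_le_one_right (zipf_nonneg hβ i) ?_
      rw [Real.exp_le_one_iff]
      have := mul_nonneg hτ0.le (zipf_nonneg hβ i); linarith
    · rw [if_pos (by simp; omega), if_neg h, add_zero]
      rcases Nat.eq_zero_or_pos i with h0 | h0
      · subst h0; rw [zipf_zero hβ]; simp; positivity
      · have hi : (0 : ℝ) < i := by exact_mod_cast h0
        have hp : 0 < zipf β i := by rw [zipf_eq]; positivity
        have hpi : 1 / zipf β i ≤ Z β * τ := by
          rw [zipf_eq, one_div_div, Real.rpow_neg hi.le, div_inv_eq_mul, ← hRβ]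
          refine mul_le_mul_of_nonneg_left ?_ hZ.le
          refine Real.rpow_le_rpow hi.le ?_ hβ0.le
          refine le_trans ?_ hNR
          exact_mod_cast (by omega : i ≤ N)
        calc zipf β i * Real.exp (-(τ * zipf β i))
            ≤ zipf β i * (2 / (τ * zipf β i) ^ 2) :=
              mul_le_mul_of_nonneg_left (exp_bd (by positivity)) hp.le
          _ = 2 / τ ^ 2 * (1 / zipf β i) := by field_simp
          _ ≤ 2 / τ ^ 2 * (Z β * τ) := mul_le_mul_of_nonneg_left hpi (by positivity)
          _ = 2 * Z β / τ := by field_simp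
  calc ∑' i : ℕ, zipf β i * Real.exp (-(τ * zipf β i)) 
      ≤ ∑' i : ℕ, ((if i ∈ Finset.range (N + 1) then 2 * Z β / τ else 0) + (if N + 1 ≤ i then zipf β i else 0)) :=
        (g_summable hβ τ hτ0.le).tsum_le_tsum hle (hsum1.add hsum2)
    _ = (N + 1) * (2 * Z β / τ) + ∑' i : ℕ, (if N + 1 ≤ i then zipf β i else 0) := by
        rw [hsum1.tsum_add hsum2]
        congr 1
        rw [tsum_eq_sum (s := Finset.range (N + 1)) (fun i hi => if_neg hi),
          Finset.sum_congr rfl (fun i hi => if_pos hi)]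
        simp
    _ ≤ (2 * R) * (2 * Z β / τ) + 1 / (β - 1) * (N : ℝ) ^ (-(β - 1)) :=
        add_le_add (mul_le_mul_of_nonneg_right (by linarith) (by positivity)) (tail_le hβ N hN1)
    _ ≤ (2 * R) * (2 * Z β / τ) + 1 / (β - 1) * ((2 : ℝ) ^ (β - 1) * R ^ (-(β - 1))) := by
        gcongr
        have := Real.rpow_le_rpow_of_nonpos (by linarith) hRN (show -(β - 1) ≤ 0 by linarith)
        refine this.trans (le_of_eq ?_)
        rw [Real.div_rpow (by linarith) (by norm_num), Real.rpow_neg (by norm_num : (0 : ℝ) ≤ 2),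
          div_inv_eq_mul, mul_comm]
    _ = B β * τ ^ (-c) := by
        have e : (2 * R) * (2 * Z β / τ) = 4 * Z β * (R / τ) := by ring
        rw [e, ← hτc, ← hτc2, B]; ring

/-- unified summand -/
noncomputable def F (β π : ℝ) (T k i : ℕ) : ℝ :=
  zipf β i * (1 - (if k + 1 ≤ i then π else 1) * zipf β i) ^ T

section
variable {β : ℝ} (hβ : 1 < β) {π : ℝ} (h0 : 0 ≤ π) (h1 : π ≤ 1) (T k : ℕ)
include hβ h0 h1

lemma base_mem (i : ℕ) : 0 ≤ 1 - (if k + 1 ≤ i then π else 1) * zipf β i ∧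
    1 - (if k + 1 ≤ i then π else 1) * zipf β i ≤ 1 := by
  have a := zipf_nonneg hβ i
  have b := zipf_le_one hβ i
  split_ifs <;> constructor <;> nlinarith

lemma F_nonneg (i : ℕ) : 0 ≤ F β π T k i :=
  mul_nonneg (zipf_nonneg hβ i) (pow_nonneg (base_mem hβ h0 h1 k i).1 _)

lemma F_le (i : ℕ) : F β π T k i ≤ zipf β i :=
  mul_le_of_le_one_right (zipf_nonneg hβ i)
    (pow_le_one₀ (base_mem hβ h0 h1 k i).1 (base_mem hβ h0 h1 k i).2)

lemma F_summable : Summable (F β π T k) :=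
  Summable.of_nonneg_of_le (F_nonneg hβ h0 h1 T k) (F_le hβ h0 h1 T k) (zipf_summable hβ)

lemma E_eq : EtestMix β π T k = ∑' i, F β π T k i := by
  have hs2 : Summable (fun i : ℕ => if k + 1 ≤ i then zipf β i * (1 - π * zipf β i) ^ T else 0) := by
    refine Summable.of_nonneg_of_le (fun i => ?_) (fun i => ?_) (F_summable hβ h0 h1 T k)
    · have := F_nonneg hβ h0 h1 T k i
      unfold F at this
      split_ifs with h
      · simpa [h] using this
      · exact le_rfl
    · have := F_nonneg hβ h0 h1 T k i
      split_ifs with h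
      · simp [F, h]
      · exact this
  have hs1 : Summable (fun i : ℕ => if i ∈ Finset.Icc 1 k then zipf β i * (1 - zipf β i) ^ T else 0) :=
    summable_of_ne_finset_zero (s := Finset.Icc 1 k) (fun i hi => if_neg hi)
  have e1 : ∑ i ∈ Finset.Icc 1 k, zipf β i * (1 - zipf β i) ^ T =
      ∑' i : ℕ, if i ∈ Finset.Icc 1 k then zipf β i * (1 - zipf β i) ^ T else 0 := by
    rw [tsum_eq_sum (s := Finset.Icc 1 k) (fun i hi => if_neg hi)]
    exact Finset.sum_congr rfl (fun i hi => (if_pos hi).symm)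
  unfold EtestMix
  rw [e1, ← hs1.tsum_add hs2]
  refine tsum_congr (fun i => ?_)
  unfold F
  by_cases h : k + 1 ≤ i
  · rw [if_neg (by simp; omega), if_pos h, if_pos h, zero_add]
  · rw [if_neg h, if_neg h, add_zero, one_mul]
    rcases Nat.eq_zero_or_pos i with h0 | h0
    · subst h0; simp [zipf_zero hβ]
    · rw [if_pos (by simp; omega)]

/-- lower bound -/
lemma E_lower (M : ℕ)
    (hM : ∀ i, M + 1 ≤ i → (T : ℝ) * ((if k + 1 ≤ i then π else 1) * zipf β i) ≤ 1 / 2) :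
    (2 : ℝ) ^ (-β) / (2 * Z β) * ((M : ℝ) + 1) ^ (-(β - 1)) ≤ EtestMix β π T k := by
  rw [E_eq hβ h0 h1]
  have hZ := Z_pos hβ
  have hM0 : (0 : ℝ) < (M : ℝ) + 1 := by positivity
  refine le_trans ?_ ((F_summable hβ h0 h1 T k).sum_le_tsum (Finset.Ico (M + 1) (2 * M + 2))
    (fun i _ => F_nonneg hβ h0 h1 T k i))
  have hterm : ∀ i ∈ Finset.Ico (M + 1) (2 * M + 2),
      (2 * ((M : ℝ) + 1)) ^ (-β) / Z β * (1 / 2) ≤ F β π T k i := by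
    intro i hi
    rw [Finset.mem_Ico] at hi
    have hi0 : (0 : ℝ) < i := by exact_mod_cast (by omega : 0 < i)
    have hi2 : (i : ℝ) ≤ 2 * ((M : ℝ) + 1) := by
      have : i ≤ 2 * (M + 1) := by omega
      exact_mod_cast this
    unfold F
    refine mul_le_mul ?_ ?_ (by norm_num) (zipf_nonneg hβ i)
    · rw [zipf_eq]
      exact div_le_div_of_nonneg_right
        (Real.rpow_le_rpow_of_nonpos hi0 hi2 (by linarith)) hZ.le
    · have hb := base_mem hβ h0 h1 k i
      have := one_add_mul_le_pow (a := -((if k + 1 ≤ i then π else 1) * zipf β i))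
        (by linarith [hb.1]) T
      have h3 := hM i hi.1
      rw [← sub_eq_add_neg] at this
      linarith
  have := Finset.card_nsmul_le_sum _ _ _ hterm
  refine le_trans (le_of_eq ?_) this
  rw [Nat.card_Ico, show 2 * M + 2 - (M + 1) = M + 1 by omega, nsmul_eq_mul,
    Real.mul_rpow (by norm_num) hM0.le, show -(β - 1) = -β + 1 by ring, Real.rpow_add_one hM0.ne']
  push_cast
  field_simp

end

noncomputable def A (β : ℝ) : ℝ := (2 : ℝ) ^ (-β) / (2 * Z β)

lemma A_pos {β : ℝ} (hβ : 1 < β) : 0 < A β := by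
  have := Z_pos hβ
  unfold A; positivity

/-- choose `M` for given `τ` -/
lemma exists_M {β : ℝ} (hβ : 1 < β) {c : ℝ} (hc : c = 1 - 1 / β) (τ : ℝ) (hτ : 1 ≤ τ) :
    ∃ M : ℕ, τ ^ (1 / β) ≤ M ∧ (∀ i : ℕ, M + 1 ≤ i → τ * zipf β i ≤ 1 / 2) ∧
      (4 : ℝ) ^ (-(β - 1)) * τ ^ (-c) ≤ ((M : ℝ) + 1) ^ (-(β - 1)) := by
  have hτ0 : 0 < τ := by linarith
  have hs : 0 < β - 1 := by linarith
  have hβ0 : 0 < β := by linarith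
  have hZ := Z_pos hβ
  set R : ℝ := τ ^ (1 / β) with hR
  have hR1 : 1 ≤ R := Real.one_le_rpow hτ (by positivity)
  have hRβ : R ^ β = τ := by
    rw [hR, ← Real.rpow_mul hτ0.le, one_div_mul_cancel hβ0.ne', Real.rpow_one]
  have hτc2 : τ ^ (-c) = R ^ (-(β - 1)) := by
    rw [hR, ← Real.rpow_mul hτ0.le, hc]; congr 1; field_simp
  refine ⟨⌈2 * R⌉₊, ?_, ?_, ?_⟩
  · have := Nat.le_ceil (2 * R); linarith
  · intro i hi
    have hi' : 2 * R ≤ i := by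
      have := Nat.le_ceil (2 * R)
      refine this.trans ?_
      exact_mod_cast (by omega : ⌈2 * R⌉₊ ≤ i)
    have hi0 : (0 : ℝ) < i := by linarith
    have h : (2 * R) ^ β ≤ (i : ℝ) ^ β := Real.rpow_le_rpow (by linarith) hi' hβ0.le
    rw [Real.mul_rpow (by norm_num) (by linarith), hRβ] at h
    have h2 : (2 : ℝ) ≤ 2 ^ β := by
      have := Real.rpow_le_rpow_of_exponent_le (show (1 : ℝ) ≤ 2 by norm_num) hβ.le
      simpa using this
    have hiβ : 0 < (i : ℝ) ^ β := by positivity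
    rw [zipf_eq, Real.rpow_neg hi0.le, ← mul_div_assoc, div_le_iff₀ hZ, ← div_eq_mul_inv,
      div_le_iff₀ hiβ]
    have hZ1 := Z_ge hβ
    nlinarith
  · rw [hτc2, ← Real.mul_rpow (by norm_num) (by linarith)]
    refine Real.rpow_le_rpow_of_nonpos (by positivity) ?_ (by linarith)
    have := Nat.ceil_lt_add_one (show 0 ≤ 2 * R by linarith)
    linarith

end Grok

/-- Grokking for a fixed-size AI dataset: with `T = T_real + T_AI`
and `π = T_real / T`, (A) for sufficiently large `k, T` with `T_real ≤ δ k^β` the test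
error is of order `(T_real + T_AI)^(-c) + k^(-(β-1))`, and (B) as soon as
`T_real ≥ C k^β` it is of order `T_real^(-c)`: after a grokking plateau, the clean
scaling law in `T_real` alone is recovered. -/
theorem grokking_fixed_AI_dataset (β : ℝ) (hβ : 1 < β) (c : ℝ) (hc : c = 1 - 1 / β) :
    (∃ δ : ℝ, 0 < δ ∧ ∃ C₁ C₂ : ℝ, 0 < C₁ ∧ 0 < C₂ ∧ ∃ k₀ T₀ : ℕ,
      ∀ k Treal TAI : ℕ, k₀ ≤ k → 1 ≤ Treal → T₀ ≤ Treal + TAI →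
        (Treal : ℝ) ≤ δ * (k : ℝ) ^ β →
        C₁ * (((Treal : ℝ) + (TAI : ℝ)) ^ (-c) + (k : ℝ) ^ (-(β - 1))) ≤
            EtestMix β ((Treal : ℝ) / ((Treal : ℝ) + (TAI : ℝ))) (Treal + TAI) k ∧
        EtestMix β ((Treal : ℝ) / ((Treal : ℝ) + (TAI : ℝ))) (Treal + TAI) k ≤
            C₂ * (((Treal : ℝ) + (TAI : ℝ)) ^ (-c) + (k : ℝ) ^ (-(β - 1)))) ∧
    (∃ C : ℝ, 0 < C ∧ ∃ C₁' C₂' : ℝ, 0 < C₁' ∧ 0 < C₂' ∧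
      ∀ k Treal TAI : ℕ, 1 ≤ Treal → C * (k : ℝ) ^ β ≤ (Treal : ℝ) →
        C₁' * (Treal : ℝ) ^ (-c) ≤
            EtestMix β ((Treal : ℝ) / ((Treal : ℝ) + (TAI : ℝ))) (Treal + TAI) k ∧
        EtestMix β ((Treal : ℝ) / ((Treal : ℝ) + (TAI : ℝ))) (Treal + TAI) k ≤
            C₂' * (Treal : ℝ) ^ (-c)) := by
  have hs : 0 < β - 1 := by linarith
  have hβ0 : 0 < β := by linarith
  have hA := Grok.A_pos hβ
  have hB := Grok.B_pos hβ
  have hZ := Grok.Z_pos hβ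
  have hZ1 := Grok.Z_ge hβ
  have hexp : ∀ x : ℝ, 0 ≤ 1 - x → ∀ n : ℕ, (1 - x) ^ n ≤ Real.exp (-((n : ℝ) * x)) := by
    intro x hx n
    have := Real.one_sub_le_exp_neg x
    calc (1 - x) ^ n ≤ (Real.exp (-x)) ^ n := pow_le_pow_left₀ hx this n
      _ = _ := by rw [← Real.exp_nat_mul]; congr 1; ring
  constructor
  · refine ⟨1 / 2, by norm_num, min (Grok.A β * 4 ^ (-(β - 1)) / 2) (Grok.A β * 2 ^ (-(β - 1)) / 2),
      max (Grok.B β) (1 / (β - 1)), by positivity, by positivity, 1, 0, ?_⟩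
    intro k Treal TAI hk hTr _ hδ
    have hTr' : (1 : ℝ) ≤ Treal := by exact_mod_cast hTr
    have hTA : (0 : ℝ) ≤ TAI := Nat.cast_nonneg _
    have hk' : (1 : ℝ) ≤ k := by exact_mod_cast hk
    set τ : ℝ := (Treal : ℝ) + (TAI : ℝ) with hτ
    have hτ1 : 1 ≤ τ := by linarith
    have hcast : ((Treal + TAI : ℕ) : ℝ) = τ := by push_cast; rfl
    set π : ℝ := (Treal : ℝ) / τ with hπ
    have h0 : 0 ≤ π := by positivity
    have h1 : π ≤ 1 := by rw [hπ, div_le_one (by linarith)]; linarith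
    have hπτ : τ * π = Treal := by rw [hπ]; field_simp
    constructor
    · have L1 : Grok.A β * (4 ^ (-(β - 1)) * τ ^ (-c)) ≤ EtestMix β π (Treal + TAI) k := by
        obtain ⟨M, -, hM, hM2⟩ := Grok.exists_M hβ hc τ hτ1
        refine (mul_le_mul_of_nonneg_left hM2 hA.le).trans ?_
        refine Grok.E_lower hβ h0 h1 _ k M (fun i hi => ?_)
        rw [hcast]
        refine le_trans (mul_le_mul_of_nonneg_left ?_ (by linarith)) (hM i hi)
        have := Grok.zipf_nonneg hβ i
        split_ifs <;> nlinarith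
      have L2 : Grok.A β * (2 ^ (-(β - 1)) * (k : ℝ) ^ (-(β - 1))) ≤
          EtestMix β π (Treal + TAI) k := by
        have hM2 : (2 : ℝ) ^ (-(β - 1)) * (k : ℝ) ^ (-(β - 1)) ≤ ((k : ℝ) + 1) ^ (-(β - 1)) := by
          rw [← Real.mul_rpow (by norm_num) (by linarith)]
          exact Real.rpow_le_rpow_of_nonpos (by positivity) (by linarith) (by linarith)
        refine (mul_le_mul_of_nonneg_left hM2 hA.le).trans ?_
        refine Grok.E_lower hβ h0 h1 _ k k (fun i hi => ?_)
        rw [hcast, if_pos hi, ← mul_assoc, hπτ]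
        have hki : (k : ℝ) ≤ i := by exact_mod_cast (by omega : k ≤ i)
        have hi0 : (0 : ℝ) < i := by linarith
        have h : (k : ℝ) ^ β ≤ (i : ℝ) ^ β := Real.rpow_le_rpow (by linarith) hki hβ0.le
        have hiβ : 0 < (i : ℝ) ^ β := by positivity
        rw [Grok.zipf_eq, Real.rpow_neg hi0.le, ← mul_div_assoc, div_le_iff₀ hZ, ← div_eq_mul_inv,
          div_le_iff₀ hiβ]
        nlinarith
      have p1 : 0 ≤ τ ^ (-c) := by positivity
      have p2 : 0 ≤ (k : ℝ) ^ (-(β - 1)) := by positivity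
      have q1 := mul_le_mul_of_nonneg_right
        (min_le_left (Grok.A β * 4 ^ (-(β - 1)) / 2) (Grok.A β * 2 ^ (-(β - 1)) / 2)) p1
      have q2 := mul_le_mul_of_nonneg_right
        (min_le_right (Grok.A β * 4 ^ (-(β - 1)) / 2) (Grok.A β * 2 ^ (-(β - 1)) / 2)) p2
      rw [mul_add]
      linarith
    · have U1 : ∑ i ∈ Finset.Icc 1 k, zipf β i * (1 - zipf β i) ^ (Treal + TAI) ≤
          Grok.B β * τ ^ (-c) := by
        refine le_trans ?_ (Grok.g_le hβ hc τ hτ1)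
        refine le_trans (Finset.sum_le_sum (fun i _ => ?_))
          ((Grok.g_summable hβ τ (by linarith)).sum_le_tsum (Finset.Icc 1 k) (fun i _ => ?_))
        · refine mul_le_mul_of_nonneg_left ?_ (Grok.zipf_nonneg hβ i)
          have := hexp (zipf β i) (by linarith [Grok.zipf_le_one hβ i]) (Treal + TAI)
          rwa [hcast] at this
        · have := Grok.zipf_nonneg hβ i
          positivity
      have U2 : (∑' i : ℕ, if k + 1 ≤ i then zipf β i * (1 - π * zipf β i) ^ (Treal + TAI) else 0) ≤
          1 / (β - 1) * (k : ℝ) ^ (-(β - 1)) := by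
        refine le_trans ?_ (Grok.tail_le hβ k hk)
        have hsum : Summable (fun i : ℕ => if k + 1 ≤ i then zipf β i else 0) := by
          refine Summable.of_nonneg_of_le (fun i => ?_) (fun i => ?_) (Grok.zipf_summable hβ)
          · split_ifs <;> simp [Grok.zipf_nonneg hβ]
          · split_ifs <;> simp [Grok.zipf_nonneg hβ]
        have hle : ∀ i : ℕ, (if k + 1 ≤ i then zipf β i * (1 - π * zipf β i) ^ (Treal + TAI) else 0) ≤
            (if k + 1 ≤ i then zipf β i else 0) := by
          intro i
          split_ifs with h
          · have := Grok.F_le hβ h0 h1 (Treal + TAI) k i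
            simpa [Grok.F, h] using this
          · exact le_rfl
        refine Summable.tsum_le_tsum hle (Summable.of_nonneg_of_le (fun i => ?_) hle hsum) hsum
        split_ifs with h
        · have := Grok.F_nonneg hβ h0 h1 (Treal + TAI) k i
          simpa only [Grok.F, if_pos h] using this
        · exact le_rfl
      have p1 : 0 ≤ τ ^ (-c) := by positivity
      have p2 : 0 ≤ (k : ℝ) ^ (-(β - 1)) := by positivity
      have q1 := mul_le_mul_of_nonneg_right (le_max_left (Grok.B β) (1 / (β - 1))) p1
      have q2 := mul_le_mul_of_nonneg_right (le_max_right (Grok.B β) (1 / (β - 1))) p2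
      unfold EtestMix
      rw [mul_add]
      linarith
  · refine ⟨1, one_pos, Grok.A β * 4 ^ (-(β - 1)), Grok.B β, by positivity, hB, ?_⟩
    intro k Treal TAI hTr hC
    rw [one_mul] at hC
    have hTr' : (1 : ℝ) ≤ Treal := by exact_mod_cast hTr
    have hTA : (0 : ℝ) ≤ TAI := Nat.cast_nonneg _
    set τ : ℝ := (Treal : ℝ) + (TAI : ℝ) with hτ
    have hτ1 : 1 ≤ τ := by linarith
    have hcast : ((Treal + TAI : ℕ) : ℝ) = τ := by push_cast; rfl
    set π : ℝ := (Treal : ℝ) / τ with hπ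
    have h0 : 0 ≤ π := by positivity
    have h1 : π ≤ 1 := by rw [hπ, div_le_one (by linarith)]; linarith
    have hπτ : τ * π = Treal := by rw [hπ]; field_simp
    constructor
    · obtain ⟨M, hM0, hM, hM2⟩ := Grok.exists_M hβ hc Treal hTr'
      rw [mul_assoc]
      refine (mul_le_mul_of_nonneg_left hM2 hA.le).trans ?_
      refine Grok.E_lower hβ h0 h1 _ k M (fun i hi => ?_)
      have hkM : (k : ℝ) ≤ M := by
        refine le_trans ?_ hM0
        have := Real.rpow_le_rpow (by positivity) hC (show 0 ≤ 1 / β by positivity)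
        rwa [← Real.rpow_mul (by positivity), mul_one_div_cancel hβ0.ne', Real.rpow_one] at this
      have hkM' : k ≤ M := by exact_mod_cast hkM
      rw [hcast, if_pos (by omega), ← mul_assoc, hπτ]
      exact hM i hi
    · rw [Grok.E_eq hβ h0 h1]
      refine le_trans ?_ (Grok.g_le hβ hc Treal hTr')
      refine (Grok.F_summable hβ h0 h1 _ k).tsum_le_tsum (fun i => ?_)
        (Grok.g_summable hβ Treal (by linarith))
      have hz := Grok.zipf_nonneg hβ i
      have hz1 := Grok.zipf_le_one hβ i
      unfold Grok.F
      refine mul_le_mul_of_nonneg_left ?_ hz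
      refine (hexp _ (Grok.base_mem hβ h0 h1 k i).1 _).trans ?_
      rw [Real.exp_le_exp, hcast, neg_le_neg_iff, ← hπτ, mul_assoc]
      refine mul_le_mul_of_nonneg_left ?_ (by linarith)
      split_ifs <;> nlinarith
end
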